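/- (Segre type [111(12)]) Let n = 3 with coordinates (u¹,u²,u³), let λ, μ be real constants, define the symmetric metric g by g₁₁ = 1 + λ(u²)² + μ(u³)², g₁₂ = −λ(u³ + u¹u²), g₁₃ = −λu² − μu¹u³, g₂₂ = λ(u¹)² + μ, g₂₃ = 2λu¹, g₃₃ = λ + μ(u¹)², and let U = {u ∈ ℝ³ : det g(u) ≠ 0 and λ(μ² − λ²)/det g(u) > 0}. Define c_{ijk} := (1/3)(∂_j g_{ik} − ∂_k g_{ij}) and the skew-symmetric field w by w₁₂ = u¹·√(λ(μ² − λ²)/det g), w₂₃ = 0, w₃₁ = √(λ(μ² − λ²)/det g) (with w_{ji} = −w_{ij}, w_{ii} = 0). Then (g, c, w) satisfies conditions (cond1) on U. -/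

import Mathlib

open scoped BigOperators

/-- Partial derivative `∂_k f` in the `k`-th coordinate direction. -/
noncomputable def pd {n : ℕ} (k : Fin n) (f : (Fin n → ℝ) → ℝ) (u : Fin n → ℝ) : ℝ :=
  fderiv ℝ f u (Pi.single k 1)

/-- Conditions (cond1) for a triple `(g, c, w)` on a set `U ⊆ ℝⁿ`:
`g` is the (lower-index) metric `g_{ij}`, `c` are the lowered coefficients `c_{ijk}`,
`w` is the skew-symmetric 2-form `w_{ij}`, and `c^s_{jk} := g^{si} c_{ijk}` is computed
via the pointwise inverse matrix `(g u)⁻¹`. -/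
def Cond1 {n : ℕ} (U : Set (Fin n → ℝ))
    (g : (Fin n → ℝ) → Matrix (Fin n) (Fin n) ℝ)
    (c : (Fin n → ℝ) → Fin n → Fin n → Fin n → ℝ)
    (w : (Fin n → ℝ) → Matrix (Fin n) (Fin n) ℝ) : Prop :=
  ∀ u ∈ U,
    (∀ i j k, pd k (fun x => g x i j) u + c u i j k + c u j i k = 0) ∧
    (∀ i j k, c u i j k + c u i k j = 0) ∧
    (∀ i j k, pd k (fun x => g x i j) u + pd i (fun x => g x j k) u
        + pd j (fun x => g x k i) u = 0) ∧
    (∀ i j, w u i j + w u j i = 0) ∧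
    (∀ i j l, pd l (fun x => w x i j) u
        = ∑ s, (∑ a, (g u)⁻¹ s a * c u a i j) * w u s l) ∧
    (∀ m l p k, pd k (fun x => c x p m l) u
        + ∑ s, (∑ a, (g u)⁻¹ s a * c u a m l) * c u s p k + w u m l * w u p k = 0)


lemma pd_of_hasDeriv {n : ℕ} (k : Fin n) (f : (Fin n → ℝ) → ℝ) (u : Fin n → ℝ)
    (hf : DifferentiableAt ℝ f u) (d : ℝ)
    (h : HasDerivAt (fun t : ℝ => f (u + t • Pi.single k (1 : ℝ))) d 0) : pd k f u = d := by
  have := hf.hasFDerivAt.hasLineDerivAt (Pi.single k (1 : ℝ))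
  exact HasDerivAt.unique this h

lemma pd_add {n : ℕ} (k : Fin n) (f h : (Fin n → ℝ) → ℝ) (u : Fin n → ℝ)
    (hf : DifferentiableAt ℝ f u) (hh : DifferentiableAt ℝ h u) :
    pd k (fun x => f x + h x) u = pd k f u + pd k h u := by
  simp [pd, fderiv_fun_add hf hh]

lemma pd_sub {n : ℕ} (k : Fin n) (f h : (Fin n → ℝ) → ℝ) (u : Fin n → ℝ)
    (hf : DifferentiableAt ℝ f u) (hh : DifferentiableAt ℝ h u) :
    pd k (fun x => f x - h x) u = pd k f u - pd k h u := by
  simp [pd, fderiv_fun_sub hf hh]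

lemma pd_neg {n : ℕ} (k : Fin n) (f : (Fin n → ℝ) → ℝ) (u : Fin n → ℝ) :
    pd k (fun x => - f x) u = - pd k f u := by
  simp [pd, fderiv_fun_neg]

lemma pd_mul {n : ℕ} (k : Fin n) (f h : (Fin n → ℝ) → ℝ) (u : Fin n → ℝ)
    (hf : DifferentiableAt ℝ f u) (hh : DifferentiableAt ℝ h u) :
    pd k (fun x => f x * h x) u = f u * pd k h u + h u * pd k f u := by
  simp [pd, fderiv_fun_mul hf hh]

lemma pd_sq {n : ℕ} (k : Fin n) (f : (Fin n → ℝ) → ℝ) (u : Fin n → ℝ)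
    (hf : DifferentiableAt ℝ f u) :
    pd k (fun x => f x ^ 2) u = 2 * f u * pd k f u := by
  simp only [pow_two]
  rw [pd_mul k f f u hf hf]; ring

lemma pd_const {n : ℕ} (k : Fin n) (a : ℝ) (u : Fin n → ℝ) :
    pd k (fun _ => a) u = 0 := by
  simp [pd]

lemma pd_coord {n : ℕ} (k i : Fin n) (u : Fin n → ℝ) :
    pd k (fun x => x i) u = if i = k then 1 else 0 := by
  have : fderiv ℝ (fun x : Fin n → ℝ => x i) u = ContinuousLinearMap.proj i :=
    (ContinuousLinearMap.proj (R := ℝ) (φ := fun _ : Fin n => ℝ) i).hasFDerivAt.fderiv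
  simp [pd, this, Pi.single_apply]

lemma pd_sqrt_div {n : ℕ} (k : Fin n) (K : ℝ) (D : (Fin n → ℝ) → ℝ) (u : Fin n → ℝ)
    (hD : DifferentiableAt ℝ D u) (h0 : D u ≠ 0) (hp : 0 < K / D u) :
    DifferentiableAt ℝ (fun x => Real.sqrt (K / D x)) u ∧
    pd k (fun x => Real.sqrt (K / D x)) u
      = - Real.sqrt (K / D u) * pd k D u / (2 * D u) := by
  have hq : HasFDerivAt (fun x => K / D x) (-(K / (D u) ^ 2) • fderiv ℝ D u) u := by
    have h1 : HasDerivAt (fun t : ℝ => K / t) (-(K / (D u) ^ 2)) (D u) := by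
      have := (hasDerivAt_inv h0).const_mul K
      simp only [div_eq_mul_inv]
      exact this.congr_deriv (by ring)
    exact h1.comp_hasFDerivAt u hD.hasFDerivAt
  have hs := hq.sqrt hp.ne'
  refine ⟨hs.differentiableAt, ?_⟩
  have hS : 0 < Real.sqrt (K / D u) := Real.sqrt_pos.2 hp
  have hSS : Real.sqrt (K / D u) ^ 2 = K / D u := Real.sq_sqrt hp.le
  have hK : K = Real.sqrt (K / D u) ^ 2 * D u := by rw [hSS]; field_simp
  unfold pd
  rw [hs.fderiv]
  simp only [smul_apply, smul_eq_mul]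
  generalize Real.sqrt (K / D u) = S at *
  rw [hK]
  field_simp

/-- Explicit table of the coefficients `c_{ijk}`. -/
def cT (l m : ℝ) (u : Fin 3 → ℝ) : Fin 3 → Matrix (Fin 3) (Fin 3) ℝ :=
  ![!![0, -(l * u 1), -(m * u 2); l * u 1, 0, 0; m * u 2, 0, 0],
    !![0, l * u 0, l; -(l * u 0), 0, 0; -l, 0, 0],
    !![0, l, m * u 0; -l, 0, 0; -(m * u 0), 0, 0]]

/-- Explicit metric. -/
def gT (l m : ℝ) (u : Fin 3 → ℝ) : Matrix (Fin 3) (Fin 3) ℝ :=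
  !![1 + l * (u 1) ^ 2 + m * (u 2) ^ 2, -(l * (u 2 + u 0 * u 1)),
           -(l * u 1) - m * u 0 * u 2;
         -(l * (u 2 + u 0 * u 1)), l * (u 0) ^ 2 + m, 2 * l * u 0;
         -(l * u 1) - m * u 0 * u 2, 2 * l * u 0, l + m * (u 0) ^ 2]

/-- Explicit derivatives of the metric. -/
def dgT (l m : ℝ) (u : Fin 3 → ℝ) : Fin 3 → Matrix (Fin 3) (Fin 3) ℝ :=
  ![!![0, -(l * u 1), -(m * u 2); -(l * u 1), 2 * l * u 0, 2 * l;
       -(m * u 2), 2 * l, 2 * m * u 0],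
    !![2 * l * u 1, -(l * u 0), -l; -(l * u 0), 0, 0; -l, 0, 0],
    !![2 * m * u 2, -l, -(m * u 0); -l, 0, 0; -(m * u 0), 0, 0]]

lemma pd_gT (l m : ℝ) (u : Fin 3 → ℝ) (k i j : Fin 3) :
    pd k (fun x => gT l m x i j) u = dgT l m u k i j := by
  fin_cases i <;> fin_cases j <;>
    simp only [gT, Fin.zero_eta, Fin.mk_one, Fin.reduceFinMk, Matrix.of_apply,
      Matrix.cons_val] <;>
    simp (disch := fun_prop) only [pd_add, pd_sub, pd_neg, pd_mul, pd_sq, pd_const, pd_coord] <;>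
    fin_cases k <;> simp [dgT] <;> ring

lemma c_eq (l m : ℝ) (u : Fin 3 → ℝ) (i j k : Fin 3) :
    (1 / 3) * (dgT l m u j i k - dgT l m u k i j) = cT l m u i j k := by
  fin_cases i <;> fin_cases j <;> fin_cases k <;> simp [dgT, cT] <;> ring

/-- Explicit derivatives of `c`: `dcT k i`. -/
def dcT (l m : ℝ) : Fin 3 → Fin 3 → Matrix (Fin 3) (Fin 3) ℝ :=
  ![![!![0, 0, 0; 0, 0, 0; 0, 0, 0], !![0, l, 0; -l, 0, 0; 0, 0, 0], !![0, 0, m; 0, 0, 0; -m, 0, 0]],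
    ![!![0, -l, 0; l, 0, 0; 0, 0, 0], !![0, 0, 0; 0, 0, 0; 0, 0, 0], !![0, 0, 0; 0, 0, 0; 0, 0, 0]],
    ![!![0, 0, -m; 0, 0, 0; m, 0, 0], !![0, 0, 0; 0, 0, 0; 0, 0, 0], !![0, 0, 0; 0, 0, 0; 0, 0, 0]]]

lemma pd_cT (l m : ℝ) (u : Fin 3 → ℝ) (k i a b : Fin 3) :
    pd k (fun x => cT l m x i a b) u = dcT l m k i a b := by
  fin_cases i <;> fin_cases a <;> fin_cases b <;>
    simp only [cT, Fin.zero_eta, Fin.mk_one, Fin.reduceFinMk, Matrix.of_apply,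
      Matrix.cons_val] <;>
    simp (disch := fun_prop) only [pd_neg, pd_mul, pd_const, pd_coord] <;>
    fin_cases k <;> simp only [dcT, Fin.zero_eta, Fin.mk_one, Fin.reduceFinMk, Matrix.of_apply, Matrix.cons_val] <;>
    simp

/-- The determinant as a polynomial. -/
def dT (l m : ℝ) (u : Fin 3 → ℝ) : ℝ :=
  (1 + l * (u 1) ^ 2 + m * (u 2) ^ 2) * ((l * (u 0) ^ 2 + m) * (l + m * (u 0) ^ 2)
      - (2 * l * u 0) ^ 2)
    - (l * (u 2 + u 0 * u 1)) ^ 2 * (l + m * (u 0) ^ 2)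
    + 2 * (l * (u 2 + u 0 * u 1)) * (2 * l * u 0) * (l * u 1 + m * u 0 * u 2)
    - (l * u 1 + m * u 0 * u 2) ^ 2 * (l * (u 0) ^ 2 + m)

lemma det_gT (l m : ℝ) (u : Fin 3 → ℝ) : (gT l m u).det = dT l m u := by
  simp [Matrix.det_fin_three, gT, dT]; ring

lemma diff_dT (l m : ℝ) (u : Fin 3 → ℝ) : DifferentiableAt ℝ (dT l m) u := by
  unfold dT; fun_prop

/-- Adjugate table. -/
def aT (l m : ℝ) (u : Fin 3 → ℝ) : Matrix (Fin 3) (Fin 3) ℝ :=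
  let p := 1 + l * (u 1) ^ 2 + m * (u 2) ^ 2
  let q := -(l * (u 2 + u 0 * u 1))
  let r := -(l * u 1) - m * u 0 * u 2
  let a := l * (u 0) ^ 2 + m
  let b := 2 * l * u 0
  let d := l + m * (u 0) ^ 2
  !![a * d - b * b, r * b - q * d, q * b - r * a;
     r * b - q * d, p * d - r * r, q * r - p * b;
     q * b - r * a, q * r - p * b, p * a - q * q]

lemma aT_eq (l m : ℝ) (u : Fin 3 → ℝ) : (gT l m u).adjugate = aT l m u := by
  rw [gT, Matrix.adjugate_fin_three_of, aT]
  ext i j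
  fin_cases i <;> fin_cases j <;> simp <;> ring

lemma inv_gT (l m : ℝ) (u : Fin 3 → ℝ) (i j : Fin 3) :
    (gT l m u)⁻¹ i j = aT l m u i j / dT l m u := by
  rw [Matrix.inv_def, det_gT, Ring.inverse_eq_inv']
  simp [aT_eq, div_eq_inv_mul]

/-- Skew matrix without the root factor. -/
def wT (u : Fin 3 → ℝ) : Matrix (Fin 3) (Fin 3) ℝ :=
  !![0, u 0, -1; -(u 0), 0, 0; 1, 0, 0]

/-- Its derivatives. -/
def dwT : Fin 3 → Matrix (Fin 3) (Fin 3) ℝ :=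
  ![!![0, 1, 0; -1, 0, 0; 0, 0, 0], !![0, 0, 0; 0, 0, 0; 0, 0, 0], !![0, 0, 0; 0, 0, 0; 0, 0, 0]]

lemma pd_wT (u : Fin 3 → ℝ) (k i j : Fin 3) :
    pd k (fun x => wT x i j) u = dwT k i j := by
  fin_cases i <;> fin_cases j <;>
    simp only [wT, Fin.zero_eta, Fin.mk_one, Fin.reduceFinMk, Matrix.of_apply,
      Matrix.cons_val] <;>
    simp (disch := fun_prop) only [pd_neg, pd_const, pd_coord] <;>
    fin_cases k <;> simp only [dwT, Fin.zero_eta, Fin.mk_one, Fin.reduceFinMk, Matrix.of_apply, Matrix.cons_val] <;>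
    simp

lemma diff_wT (u : Fin 3 → ℝ) (i j : Fin 3) :
    DifferentiableAt ℝ (fun x => wT x i j) u := by
  fin_cases i <;> fin_cases j <;> simp [wT] <;> fun_prop

/-- Derivatives of the determinant. -/
def ddT (l m : ℝ) (u : Fin 3 → ℝ) (k : Fin 3) : ℝ :=
  ∑ i, ∑ j, aT l m u i j * dgT l m u k j i

lemma pd_dT (l m : ℝ) (u : Fin 3 → ℝ) (k : Fin 3) :
    pd k (dT l m) u = ddT l m u k := by
  have : dT l m = fun u => dT l m u := rfl
  rw [this]
  simp (disch := fun_prop) only [dT, pd_add, pd_sub, pd_mul, pd_sq, pd_const, pd_coord]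
  fin_cases k <;>simp only [ddT, Fin.sum_univ_three, aT, dgT, Fin.zero_eta, Fin.mk_one, Fin.reduceFinMk, Matrix.of_apply, Matrix.cons_val] <;>
    simp <;> ring

lemma key5 (l m : ℝ) (u : Fin 3 → ℝ) (i j k : Fin 3) :
    2 * dT l m u * dwT k i j - wT u i j * ddT l m u k
      = 2 * ∑ s, (∑ a, aT l m u s a * cT l m u a i j) * wT u s k := by
  fin_cases i <;> fin_cases j <;> fin_cases k <;>
    simp only [ddT, Fin.sum_univ_three, dT, aT, dgT, cT, wT, dwT, Fin.zero_eta, Fin.mk_one, Fin.reduceFinMk, Matrix.of_apply, Matrix.cons_val] <;>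
    ring

lemma key6 (l m : ℝ) (u : Fin 3 → ℝ) (a b p k : Fin 3) :
    dT l m u * dcT l m k p a b + ∑ s, (∑ t, aT l m u s t * cT l m u t a b) * cT l m u s p k
      + l * (m ^ 2 - l ^ 2) * (wT u a b * wT u p k) = 0 := by
  fin_cases a <;> fin_cases b <;> fin_cases p <;> fin_cases k <;>
    simp only [Fin.sum_univ_three, dT, aT, dcT, cT, wT, Fin.zero_eta, Fin.mk_one, Fin.reduceFinMk, Matrix.of_apply, Matrix.cons_val] <;>
    ring

/-- Segre type [111(12)]. With `(u¹,u²,u³) = (u 0, u 1, u 2)`, `λ μ : ℝ`,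
metric as indicated, `U = {u : det g(u) ≠ 0 ∧ λ(μ²−λ²)/det g(u) > 0}`,
`c_{ijk} = (1/3)(∂_j g_{ik} − ∂_k g_{ij})` and the skew form with
`w₁₂ = u¹√(λ(μ²−λ²)/det g)`, `w₂₃ = 0`, `w₃₁ = √(λ(μ²−λ²)/det g)`,
conditions (cond1) hold on `U`. -/
theorem segre_11112_first_satisfies_cond1 (l m : ℝ)
    (g : (Fin 3 → ℝ) → Matrix (Fin 3) (Fin 3) ℝ)
    (hg : g = fun u =>
      !![1 + l * (u 1) ^ 2 + m * (u 2) ^ 2, -(l * (u 2 + u 0 * u 1)),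
           -(l * u 1) - m * u 0 * u 2;
         -(l * (u 2 + u 0 * u 1)), l * (u 0) ^ 2 + m, 2 * l * u 0;
         -(l * u 1) - m * u 0 * u 2, 2 * l * u 0, l + m * (u 0) ^ 2])
    (U : Set (Fin 3 → ℝ))
    (hU : U = {u | (g u).det ≠ 0 ∧ 0 < l * (m ^ 2 - l ^ 2) / (g u).det})
    (c : (Fin 3 → ℝ) → Fin 3 → Fin 3 → Fin 3 → ℝ)
    (hc : c = fun u i j k =>
      (1 / 3) * (pd j (fun x => g x i k) u - pd k (fun x => g x i j) u))
    (w : (Fin 3 → ℝ) → Matrix (Fin 3) (Fin 3) ℝ)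
    (hw : w = fun u =>
      !![0, u 0 * Real.sqrt (l * (m ^ 2 - l ^ 2) / (g u).det),
           -(Real.sqrt (l * (m ^ 2 - l ^ 2) / (g u).det));
         -(u 0 * Real.sqrt (l * (m ^ 2 - l ^ 2) / (g u).det)), 0, 0;
         Real.sqrt (l * (m ^ 2 - l ^ 2) / (g u).det), 0, 0]) :
    Cond1 U g c w := by
  have hg' : g = gT l m := hg
  clear hg
  subst hg'
  have hc' : c = fun u i j k => cT l m u i j k := by
    rw [hc]; funext u i j k
    rw [pd_gT, pd_gT, c_eq]
  clear hc
  subst hc'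
  have hw' : w = fun u i j => wT u i j * Real.sqrt (l * (m ^ 2 - l ^ 2) / dT l m u) := by
    rw [hw]; funext u i j
    rw [det_gT]
    fin_cases i <;> fin_cases j <;> simp [wT]
  clear hw
  subst hw'
  subst hU
  rintro u ⟨h0, hp⟩
  rw [det_gT] at h0 hp
  refine ⟨?_, ?_, ?_, ?_, ?_, ?_⟩
  · intro i j k
    rw [pd_gT]
    fin_cases i <;> fin_cases j <;> fin_cases k <;> simp [dgT, cT] <;> ring
  · intro i j k
    fin_cases i <;> fin_cases j <;> fin_cases k <;> simp [cT]
  · intro i j k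
    rw [pd_gT, pd_gT, pd_gT]
    fin_cases i <;> fin_cases j <;> fin_cases k <;> simp [dgT] <;> ring
  · intro i j
    fin_cases i <;> fin_cases j <;> simp [wT]
  · intro i j k
    obtain ⟨hd, hpd⟩ := pd_sqrt_div k _ _ u (diff_dT l m u) h0 hp
    rw [pd_mul k _ _ u (diff_wT u i j) hd, hpd, pd_wT, pd_dT]
    have h5 := key5 l m u i j k
    simp only [inv_gT]
    simp only [Fin.sum_univ_three] at h5 ⊢
    field_simp
    linear_combination h5
  · intro a b p k
    have h6 := key6 l m u a b p k
    have hS := Real.mul_self_sqrt hp.le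
    simp only [inv_gT]
    rw [pd_cT]
    generalize Real.sqrt (l * (m ^ 2 - l ^ 2) / dT l m u) = S at *
    have hS' : S * S * dT l m u = l * (m ^ 2 - l ^ 2) := by rw [hS]; field_simp
    simp only [Fin.sum_univ_three] at h6 ⊢
    field_simp
    linear_combination h6 + wT u a b * wT u p k * hS'
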